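/- Let P and Q be polytopes in ℝ². If for every unit vector u ∈ ℝ² the faces P_u = {x ∈ P : ⟨x,u⟩ = max_{y∈P} ⟨y,u⟩} and Q_u = {x ∈ Q : ⟨x,u⟩ = max_{y∈Q} ⟨y,u⟩} differ only by a translation (i.e., Q_u = P_u + t for some t ∈ ℝ² depending on u), then P and Q differ only by a translation: Q = P + t for some t ∈ ℝ². -/

import Mathlib

noncomputable section

/-- The face of `P` supported in direction `u`:
`{x ∈ P : ⟨x,u⟩ = max_{y ∈ P} ⟨y,u⟩}`. -/
def faceOf {n : ℕ} (P : Set (Fin n → ℝ)) (u : Fin n → ℝ) : Set (Fin n → ℝ) :=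
  {x ∈ P | ∀ y ∈ P, ∑ i, y i * u i ≤ ∑ i, x i * u i}

theorem mem_faceOf {n : ℕ} {P : Set (Fin n → ℝ)} {u x : Fin n → ℝ} :
    x ∈ faceOf P u ↔ x ∈ P ∧ ∀ y ∈ P, y ⬝ᵥ u ≤ x ⬝ᵥ u := Iff.rfl

theorem faceOf_subset {n : ℕ} (P : Set (Fin n → ℝ)) (u : Fin n → ℝ) : faceOf P u ⊆ P :=
  fun _ hx => hx.1

theorem IsCompact.faceOf_nonempty {n : ℕ} {K : Set (Fin n → ℝ)} (hK : IsCompact K)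
    (hne : K.Nonempty) (u : Fin n → ℝ) : (faceOf K u).Nonempty := by
  obtain ⟨x, hx, hmax⟩ := hK.exists_isMaxOn (f := fun x => x ⬝ᵥ u) hne
    (Continuous.continuousOn (by unfold dotProduct; fun_prop))
  exact ⟨x, hx, fun y hy => hmax hy⟩

theorem faceOf_image_add_right {n : ℕ} (A : Set (Fin n → ℝ)) (t u : Fin n → ℝ) :
    faceOf ((fun x => x + t) '' A) u = (fun x => x + t) '' faceOf A u := by
  ext x
  constructor
  · rintro ⟨⟨a, ha, rfl⟩, hmax⟩
    refine ⟨a, mem_faceOf.2 ⟨ha, fun y hy => ?_⟩, rfl⟩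
    have hya : (y + t) ⬝ᵥ u ≤ (a + t) ⬝ᵥ u := hmax (y + t) ⟨y, hy, rfl⟩
    simpa [add_dotProduct] using hya
  · rintro ⟨a, ha, rfl⟩
    refine mem_faceOf.2 ⟨⟨a, ha.1, rfl⟩, ?_⟩
    rintro _ ⟨y, hy, rfl⟩
    simpa [add_dotProduct] using (mem_faceOf.1 ha).2 y hy

/-- Taking faces commutes with taking convex hulls. -/
theorem faceOf_convexHull {n : ℕ} (V : Set (Fin n → ℝ)) (u : Fin n → ℝ) :
    faceOf (convexHull ℝ V) u = convexHull ℝ (faceOf V u) := by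
  have hlin : IsLinearMap ℝ fun y : Fin n → ℝ => y ⬝ᵥ u :=
    ⟨fun a b => add_dotProduct a b u, fun r a => smul_dotProduct r a u⟩
  have hle : ∀ {W : Set (Fin n → ℝ)} {c : ℝ}, (∀ y ∈ W, y ⬝ᵥ u ≤ c) →
      ∀ y ∈ convexHull ℝ W, y ⬝ᵥ u ≤ c :=
    fun hW => convexHull_min hW (convex_halfSpace_le hlin _)
  apply Set.Subset.antisymm
  · intro x hx
    obtain ⟨hxV, hmax⟩ := mem_faceOf.1 hx
    have hV : ∀ y ∈ V, y ⬝ᵥ u ≤ x ⬝ᵥ u := fun y hy => hmax y (subset_convexHull ℝ V hy)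
    have hH : ∀ y ∈ convexHull ℝ (faceOf V u), y ⬝ᵥ u ≤ x ⬝ᵥ u :=
      hle fun y hy => hV y hy.1
    have hconv : Convex ℝ {y | y ⬝ᵥ u < x ⬝ᵥ u ∨ y ∈ convexHull ℝ (faceOf V u)} := by
      rw [convex_iff_forall_pos]
      intro y hy z hz a b ha hb hab
      by_cases h : y ∈ convexHull ℝ (faceOf V u) ∧ z ∈ convexHull ℝ (faceOf V u)
      · exact Or.inr (convex_convexHull ℝ _ h.1 h.2 ha.le hb.le hab)
      · left
        have key : ∀ w, (w ⬝ᵥ u < x ⬝ᵥ u ∨ w ∈ convexHull ℝ (faceOf V u)) →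
            w ⬝ᵥ u ≤ x ⬝ᵥ u := fun w hw => hw.elim le_of_lt (hH w)
        have hy' := key y hy
        have hz' := key z hz
        rw [add_dotProduct, smul_dotProduct, smul_dotProduct, smul_eq_mul, smul_eq_mul]
        have hc : a * (x ⬝ᵥ u) + b * (x ⬝ᵥ u) = x ⬝ᵥ u := by rw [← add_mul, hab, one_mul]
        by_cases hyF : y ∈ convexHull ℝ (faceOf V u)
        · have hzlt := hz.resolve_right fun hzF => h ⟨hyF, hzF⟩
          nlinarith
        · have hylt := hy.resolve_right hyF
          nlinarith
    refine (convexHull_min (fun v hv => ?_) hconv hxV).resolve_left (lt_irrefl _)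
    rcases (hV v hv).lt_or_eq with hlt | heq
    · exact Or.inl hlt
    · exact Or.inr (subset_convexHull ℝ _ (mem_faceOf.2 ⟨hv, fun y hy => heq ▸ hV y hy⟩))
  · intro x hx
    refine mem_faceOf.2 ⟨convexHull_mono (faceOf_subset V u) hx, hle fun y hy => ?_⟩
    exact convexHull_min (fun z hz => (mem_faceOf.1 hz).2 y hy) (convex_halfSpace_ge hlin _) hx

/-- In directions close to `u`, the faces of a finite set are the faces of its face in
direction `u`. -/
theorem Set.Finite.eventually_faceOf_faceOf {n : ℕ} {V : Set (Fin n → ℝ)} (hV : V.Finite)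
    (u : Fin n → ℝ) : ∀ᶠ v in nhds u, faceOf V v = faceOf (faceOf V u) v := by
  have hlt : ∀ᶠ v in nhds u, ∀ p ∈ V, ∀ q ∈ V, p ⬝ᵥ u < q ⬝ᵥ u → p ⬝ᵥ v < q ⬝ᵥ v := by
    refine (Filter.eventually_all_finite hV).2 fun p _ =>
      (Filter.eventually_all_finite hV).2 fun q _ => ?_
    by_cases h : p ⬝ᵥ u < q ⬝ᵥ u
    · have hc : ∀ w : Fin n → ℝ, Continuous fun v => w ⬝ᵥ v := fun w => by
        unfold dotProduct; fun_prop
      filter_upwards [(isOpen_lt (hc p) (hc q)).mem_nhds h] with v hv _ using hv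
    · exact Filter.Eventually.of_forall fun v hv => absurd hv h
  filter_upwards [hlt] with v hv
  ext x
  constructor
  · intro hx
    obtain ⟨hxV, hmax⟩ := mem_faceOf.1 hx
    refine mem_faceOf.2 ⟨mem_faceOf.2 ⟨hxV, fun y hy => ?_⟩, fun y hy => hmax y hy.1⟩
    by_contra! hxy
    exact absurd (hmax y hy) (not_le.2 (hv x hxV y hy hxy))
  · intro hx
    obtain ⟨hxF, hmax⟩ := mem_faceOf.1 hx
    obtain ⟨hxV, hmaxu⟩ := mem_faceOf.1 hxF
    refine mem_faceOf.2 ⟨hxV, fun y hy => ?_⟩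
    rcases (hmaxu y hy).lt_or_eq with hyx | hyx
    · exact (hv y hy x hxV hyx).le
    · exact hmax y (mem_faceOf.2 ⟨hy, fun z hz => hyx ▸ hmaxu z hz⟩)

theorem eventually_faceOf_faceOf_convexHull {n : ℕ} {V : Set (Fin n → ℝ)} (hV : V.Finite)
    (u : Fin n → ℝ) :
    ∀ᶠ v in nhds u,
      faceOf (convexHull ℝ V) v = faceOf (faceOf (convexHull ℝ V) u) v := by
  filter_upwards [hV.eventually_faceOf_faceOf u] with v hv
  rw [faceOf_convexHull, faceOf_convexHull, faceOf_convexHull, hv]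

theorem faceOf_smul {n : ℕ} (P : Set (Fin n → ℝ)) {c : ℝ} (hc : 0 < c) (u : Fin n → ℝ) :
    faceOf P (c • u) = faceOf P u := by
  ext x
  simp only [mem_faceOf, dotProduct_smul, smul_eq_mul, mul_le_mul_iff_right₀ hc]

theorem isCompact_faceOf {n : ℕ} {K : Set (Fin n → ℝ)} (hK : IsCompact K) (u : Fin n → ℝ) :
    IsCompact (faceOf K u) := by
  have hc : Continuous fun x : Fin n → ℝ => x ⬝ᵥ u := by unfold dotProduct; fun_prop
  have : faceOf K u = K ∩ ⋂ y ∈ K, {x | y ⬝ᵥ u ≤ x ⬝ᵥ u} := by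
    ext x
    simp [mem_faceOf]
  rw [this]
  exact hK.inter_right (isClosed_biInter fun y _ => isClosed_le continuous_const hc)

/-- The translation vector between two translates of a nonempty compact set is unique. -/
theorem IsCompact.eq_of_image_add_right_eq {n : ℕ} {K : Set (Fin n → ℝ)} (hK : IsCompact K)
    (hne : K.Nonempty) {s t : Fin n → ℝ}
    (h : (fun x => x + s) '' K = (fun x => x + t) '' K) : s = t := by
  obtain ⟨x, hx⟩ := hK.faceOf_nonempty hne (s - t)
  obtain ⟨y, hy, hyx⟩ : x + s ∈ (fun x => x + t) '' K := h ▸ ⟨x, hx.1, rfl⟩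
  have hy' : y = x + (s - t) := by
    rw [← add_sub_assoc, ← hyx, add_sub_cancel_right]
  have hle := (mem_faceOf.1 hx).2 y hy
  rw [hy', add_dotProduct] at hle
  have h0 : (s - t) ⬝ᵥ (s - t) = 0 :=
    le_antisymm (by linarith) (Finset.sum_nonneg fun i _ => mul_self_nonneg _)
  exact sub_eq_zero.1 (dotProduct_self_eq_zero.1 h0)

/-- A closed convex set containing all proper faces of a compact set contains that set. -/
theorem IsCompact.subset_of_faceOf_subset {n : ℕ} {K L : Set (Fin n → ℝ)} (hK : IsCompact K)
    (hL : IsClosed L) (hLc : Convex ℝ L) (hLne : L.Nonempty)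
    (h : ∀ u ≠ 0, faceOf K u ⊆ L) : K ⊆ L := by
  intro x hx
  by_contra hxL
  obtain ⟨f, s, hfL, hfx⟩ := geometric_hahn_banach_closed_point hLc hL hxL
  obtain ⟨u, hu⟩ : ∃ u : Fin n → ℝ, ∀ y, f y = y ⬝ᵥ u :=
    ⟨fun i => f fun j => if i = j then 1 else 0, fun y => by
      simpa [dotProduct] using (f : (Fin n → ℝ) →ₗ[ℝ] ℝ).pi_apply_eq_sum_univ y⟩
  have hu0 : u ≠ 0 := by
    rintro rfl
    obtain ⟨l, hl⟩ := hLne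
    have h1 := hfL l hl
    rw [hu, dotProduct_zero] at h1 hfx
    exact lt_asymm h1 hfx
  obtain ⟨y, hy⟩ := hK.faceOf_nonempty ⟨x, hx⟩ u
  have hyx := (mem_faceOf.1 hy).2 x hx
  have hys := hfL y (h u hu0 hy)
  rw [hu] at hys hfx
  linarith

/-- If two polytopes `P, Q` in the plane are such that for every unit vector
`u` the faces `P_u` and `Q_u` differ only by a translation, then `P` and `Q` differ only by a
translation. -/
theorem faces_translates_imp_translate (VP VQ : Finset (Fin 2 → ℝ))
    (hVP : VP.Nonempty) (hVQ : VQ.Nonempty)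
    (P Q : Set (Fin 2 → ℝ))
    (hP : P = convexHull ℝ (VP : Set (Fin 2 → ℝ)))
    (hQ : Q = convexHull ℝ (VQ : Set (Fin 2 → ℝ)))
    (h : ∀ u : Fin 2 → ℝ, ‖u‖ = 1 →
      ∃ t : Fin 2 → ℝ, faceOf Q u = (fun x => x + t) '' faceOf P u) :
    ∃ t : Fin 2 → ℝ, Q = (fun x => x + t) '' P := by
  have hPc : IsCompact P := hP ▸ VP.finite_toSet.isCompact_convexHull ℝ
  have hQc : IsCompact Q := hQ ▸ VQ.finite_toSet.isCompact_convexHull ℝ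
  have hPne : P.Nonempty := hP ▸ (Finset.coe_nonempty.2 hVP).convexHull
  have hQne : Q.Nonempty := hQ ▸ (Finset.coe_nonempty.2 hVQ).convexHull
  have hPconv : Convex ℝ P := hP ▸ convex_convexHull ℝ _
  have hQconv : Convex ℝ Q := hQ ▸ convex_convexHull ℝ _
  have hT : ∀ u : Fin 2 → ℝ, ∃ t : Fin 2 → ℝ,
      u ≠ 0 → faceOf Q u = (fun x => x + t) '' faceOf P u := by
    intro u
    by_cases hu : u = 0
    · exact ⟨0, fun h0 => absurd hu h0⟩
    · obtain ⟨t, ht⟩ := h (‖u‖⁻¹ • u) (norm_smul_inv_norm (𝕜 := ℝ) hu)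
      have hpos : 0 < ‖u‖⁻¹ := inv_pos.2 (norm_pos_iff.2 hu)
      exact ⟨t, fun _ => by rwa [faceOf_smul Q hpos, faceOf_smul P hpos] at ht⟩
  choose T hT using hT
  have hloc : ∀ u ≠ 0, ∀ᶠ v in nhds u, T u = T v := by
    intro u hu
    have hPu := eventually_faceOf_faceOf_convexHull VP.finite_toSet u
    have hQu := eventually_faceOf_faceOf_convexHull VQ.finite_toSet u
    rw [← hP] at hPu
    rw [← hQ] at hQu
    filter_upwards [hPu, hQu, isOpen_ne.mem_nhds hu] with v hPv hQv hv
    refine (isCompact_faceOf hPc v).eq_of_image_add_right_eq (hPc.faceOf_nonempty hPne v) ?_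
    rw [← hT v hv, hQv, hT u hu, faceOf_image_add_right, ← hPv]
  have hconn : IsPreconnected ({0}ᶜ : Set (Fin 2 → ℝ)) :=
    (isConnected_compl_singleton_of_one_lt_rank (by simp) 0).isPreconnected
  have hconst : ∀ u ≠ 0, ∀ v ≠ 0, T u = T v := fun u hu v hv =>
    hconn.induction₂ (fun u v => T u = T v)
      (fun x hx => (hloc x hx).filter_mono nhdsWithin_le_nhds)
      (fun _ _ _ _ _ _ => Eq.trans) (fun _ _ _ _ => Eq.symm) hu hv
  have hface : ∀ u ≠ 0, faceOf Q u = (fun x => x + T 1) '' faceOf P u := fun u hu =>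
    hconst u hu 1 one_ne_zero ▸ hT u hu
  have hPt : IsCompact ((fun x => x + T 1) '' P) := hPc.image (by fun_prop)
  refine ⟨T 1, Set.Subset.antisymm ?_ ?_⟩
  · refine hQc.subset_of_faceOf_subset hPt.isClosed ?_ (hPne.image _) fun u hu => ?_
    · simpa only [add_comm] using hPconv.translate (T 1)
    · rw [hface u hu]
      exact Set.image_mono (faceOf_subset P u)
  · refine hPt.subset_of_faceOf_subset hQc.isClosed hQconv hQne fun u hu => ?_
    rw [faceOf_image_add_right, ← hface u hu]
    exact faceOf_subset Q u
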